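/- arXiv:2106.08923 — 3 statements merged into one kernel-verified Lean document; each statement's English description precedes it below -/
import Mathlib

section
/- Let d ≥ 1 and let t_1, …, t_n be distinct real numbers. Let p_i = (t_i, t_i^2, …, t_i^d) ∈ ℝ^d be the corresponding points on the moment curve and let q_i = (1, t_i, …, t_i^{d−1}) ∈ ℝ^d. Then for every set E of pairs {i,j} with 1 ≤ i < j ≤ n, the rows of the bar-and-joint rigidity matrix R(p) indexed by E are linearly independent if and only if the rows of the hyperconnectivity matrix H(q) indexed by E are linearly independent. (That is, the bar-and-joint rigidity matroid of points along the moment curve equals the d-dimensional hyperconnectivity matroid of the vectors (1, t_i, …, t_i^{d−1}).) -/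
/-- Row of the bar-and-joint rigidity matrix indexed by the ordered pair `e = (i, j)`:
block `i` contains `p i - p j`, block `j` contains `p j - p i`, other blocks are zero. -/
def rigRow {n d : ℕ} (p : Fin n → Fin d → ℝ) (e : Fin n × Fin n) :
    Fin n → Fin d → ℝ :=
  fun k => if k = e.1 then p e.1 - p e.2 else if k = e.2 then p e.2 - p e.1 else 0

/-- Row of the hyperconnectivity matrix indexed by the ordered pair `e = (i, j)`:
block `i` contains `q j`, block `j` contains `-q i`, other blocks are zero. -/
def hypRow {n d : ℕ} (q : Fin n → Fin d → ℝ) (e : Fin n × Fin n) :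
    Fin n → Fin d → ℝ :=
  fun k => if k = e.1 then q e.2 else if k = e.2 then -q e.1 else 0

/-- Blockwise map `w ↦ (w_k - t_i w_{k-1})_k`, with `w_{-1} = 0`. -/
def shiftMap {n d : ℕ} (t : Fin n → ℝ) :
    (Fin n → Fin d → ℝ) →ₗ[ℝ] (Fin n → Fin d → ℝ) where
  toFun w := fun i k => w i k -
    (if h : 0 < (k : ℕ) then t i * w i ⟨(k : ℕ) - 1, by omega⟩ else 0)
  map_add' x y := by
    funext i k
    by_cases h : 0 < (k : ℕ)
    · simp only [h, dif_pos, Pi.add_apply]; ring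
    · simp [h]
  map_smul' c x := by
    funext i k
    by_cases h : 0 < (k : ℕ)
    · simp only [h, dif_pos, Pi.smul_apply, smul_eq_mul, RingHom.id_apply]; ring
    · simp [h]

lemma shiftMap_ker {n d : ℕ} (t : Fin n → ℝ) :
    LinearMap.ker (shiftMap (d := d) t) = ⊥ := by
  rw [LinearMap.ker_eq_bot']
  intro w hw
  have key : ∀ i, ∀ k : ℕ, ∀ hk : k < d, w i ⟨k, hk⟩ = 0 := by
    intro i k
    induction k with
    | zero =>
      intro hk
      have h := congrFun (congrFun hw i) ⟨0, hk⟩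
      simpa [shiftMap] using h
    | succ k ih =>
      intro hk
      have h := congrFun (congrFun hw i) ⟨k + 1, hk⟩
      simpa [shiftMap, ih (by omega)] using h
  funext i k
  exact key i k k.2

lemma shiftMap_rigRow {n d : ℕ} (t : Fin n → ℝ) (p q : Fin n → Fin d → ℝ)
    (hp : ∀ i k, p i k = t i ^ ((k : ℕ) + 1))
    (hq : ∀ i k, q i k = t i ^ (k : ℕ)) (e : Fin n × Fin n) :
    shiftMap t (rigRow p e) = (t e.1 - t e.2) • hypRow q e := by
  funext i ⟨k, hk⟩
  by_cases h1 : i = e.1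
  · subst h1
    rcases k with _ | k
    · simp [shiftMap, rigRow, hypRow, hp, hq]
    · simp [shiftMap, rigRow, hypRow, hp, hq]
      ring
  · by_cases h2 : i = e.2
    · subst h2
      rcases k with _ | k
      · simp [shiftMap, rigRow, hypRow, hp, hq, h1]
      · simp [shiftMap, rigRow, hypRow, hp, hq, h1]
        ring
    · simp [shiftMap, rigRow, hypRow, h1, h2]

/-- For distinct reals `t₁, …, tₙ`, the bar-and-joint rigidity matroid of the points
`pᵢ = (tᵢ, tᵢ², …, tᵢ^d)` on the moment curve coincides with the `d`-dimensional
hyperconnectivity matroid of the vectors `qᵢ = (1, tᵢ, …, tᵢ^{d-1})`. -/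
theorem momentCurve_rigidity_eq_hyperconnectivity
    (d n : ℕ) (hd : 1 ≤ d) (t : Fin n → ℝ) (ht : Function.Injective t)
    (p q : Fin n → Fin d → ℝ)
    (hp : ∀ i k, p i k = t i ^ ((k : ℕ) + 1))
    (hq : ∀ i k, q i k = t i ^ (k : ℕ))
    (E : Set (Fin n × Fin n)) (hE : ∀ e ∈ E, e.1 < e.2) :
    LinearIndependent ℝ (fun e : E => rigRow p e.1) ↔
      LinearIndependent ℝ (fun e : E => hypRow q e.1) := by
  have hne : ∀ e : E, t e.1.1 - t e.1.2 ≠ 0 := fun e =>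
    sub_ne_zero.2 fun h => (hE e.1 e.2).ne (ht h)
  rw [← LinearMap.linearIndependent_iff (shiftMap t) (shiftMap_ker t),
    ← LinearIndependent.units_smul_iff (v := fun e : E => hypRow q e.1)
      (w := fun e => Units.mk0 _ (hne e))]
  have : (shiftMap t ∘ fun e : E => rigRow p e.1) =
      (fun e : E => Units.mk0 _ (hne e)) • fun e : E => hypRow q e.1 := by
    funext e
    exact shiftMap_rigRow t p q hp hq e.1
  rw [this]
end

section
/- Let d ≥ 1, let t_1, …, t_n be real numbers, and for each i ∈ {1,…,n} let F^i = (f^i_1, …, f^i_d) and G^i = (g^i_1, …, g^i_d) be two bases of the d-dimensional real vector space ℝ[t]_{<d} of univariate polynomials of degree less than d. Then the linear matroid of rows of the polynomial rigidity matrix P_{F^1,…,F^n}(t_1,…,t_n) equals that of P_{G^1,…,G^n}(t_1,…,t_n): for every set E of pairs {i,j} with 1 ≤ i < j ≤ n, the rows of the first matrix indexed by E are linearly independent if and only if the corresponding rows of the second matrix are linearly independent. -/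
/-- Row of the polynomial rigidity matrix `P_{F¹,…,Fⁿ}(t₁,…,tₙ)` indexed by the ordered
pair `e = (i, j)`: block `i` contains the vector `Fⁱ(tⱼ)` of evaluations, block `j`
contains `-Fʲ(tᵢ)`, other blocks are zero. -/
def polyRow {n d : ℕ} (F : Fin n → Fin d → Polynomial ℝ) (t : Fin n → ℝ)
    (e : Fin n × Fin n) : Fin n → Fin d → ℝ :=
  fun m =>
    if m = e.1 then fun k => (F e.1 k).eval (t e.2)
    else if m = e.2 then fun k => -(F e.2 k).eval (t e.1)
    else 0

/-- If every `F i k` is in the span of `G i`, then independence of the `F`-rows implies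
independence of the `G`-rows: the `F`-rows are a linear image of the `G`-rows. -/
theorem polyRow_independent_aux {d n : ℕ} (t : Fin n → ℝ)
    (F G : Fin n → Fin d → Polynomial ℝ)
    (h : ∀ i k, F i k ∈ Submodule.span ℝ (Set.range (G i)))
    (E : Set (Fin n × Fin n))
    (hF : LinearIndependent ℝ (fun e : E => polyRow F t e.1)) :
    LinearIndependent ℝ (fun e : E => polyRow G t e.1) := by
  have h2 : ∀ i k, ∃ c : Fin d → ℝ, ∑ l, c l • G i l = F i k := fun i k =>
    (Submodule.mem_span_range_iff_exists_fun ℝ).1 (h i k)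
  choose c hc using h2
  have hev : ∀ i k x, (F i k).eval x = ∑ l, c i k l * (G i l).eval x := by
    intro i k x
    rw [← hc i k, Polynomial.eval_finset_sum]
    simp
  let L : (Fin n → Fin d → ℝ) →ₗ[ℝ] (Fin n → Fin d → ℝ) :=
    { toFun := fun v m k => ∑ l, c m k l * v m l
      map_add' := by
        intro v w
        ext m k
        simp [mul_add, Finset.sum_add_distrib]
      map_smul' := by
        intro r v
        ext m k
        simp only [Pi.smul_apply, smul_eq_mul, RingHom.id_apply, Finset.mul_sum]
        exact Finset.sum_congr rfl fun l _ => by ring }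
  apply LinearIndependent.of_comp L
  convert hF using 1
  funext e
  ext m k
  change ∑ l, c m k l * polyRow G t e.1 m l = polyRow F t e.1 m k
  unfold polyRow
  by_cases h1 : m = e.1.1
  · subst h1
    simp [hev]
  · by_cases h2 : m = e.1.2
    · subst h2
      simp [h1, hev]
    · simp [h1, h2]

/-- The linear matroid of rows of the polynomial rigidity matrix does not depend on the
choice, for each index `i`, of a basis `Fⁱ` of the space `ℝ[t]_{<d}` of polynomials of
degree less than `d`. -/
theorem polyRigidity_independent_of_bases
    (d n : ℕ) (hd : 1 ≤ d) (t : Fin n → ℝ)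
    (F G : Fin n → Fin d → Polynomial ℝ)
    (hFind : ∀ i, LinearIndependent ℝ (F i))
    (hFspan : ∀ i, Submodule.span ℝ (Set.range (F i)) = Polynomial.degreeLT ℝ d)
    (hGind : ∀ i, LinearIndependent ℝ (G i))
    (hGspan : ∀ i, Submodule.span ℝ (Set.range (G i)) = Polynomial.degreeLT ℝ d)
    (E : Set (Fin n × Fin n)) (hE : ∀ e ∈ E, e.1 < e.2) :
    LinearIndependent ℝ (fun e : E => polyRow F t e.1) ↔
      LinearIndependent ℝ (fun e : E => polyRow G t e.1) := by
  constructor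
  · refine polyRow_independent_aux t F G (fun i k => ?_) E
    rw [hGspan i, ← hFspan i]
    exact Submodule.subset_span ⟨k, rfl⟩
  · refine polyRow_independent_aux t G F (fun i k => ?_) E
    rw [hFspan i, ← hGspan i]
    exact Submodule.subset_span ⟨k, rfl⟩
end

section
/- Let V = X ⊔ Y be a finite vertex set with a bipartition and let p_i ∈ ℝ^{d−1} for each i ∈ V. Define points q_i ∈ ℝ^d by q_i = (p_i, 0) for i ∈ X and q_j = (p_j, 1) for j ∈ Y, and define vectors w_i = (p_i, 1) ∈ ℝ^d for all i ∈ V. Then for every set E of edges between X and Y (i.e., E ⊆ X × Y), the rows of the bar-and-joint rigidity matrix R(q) indexed by E are linearly independent if and only if the rows of the hyperconnectivity matrix H(w) indexed by E are linearly independent. -/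
/-- Row of the bar-and-joint rigidity matrix over a vertex type `V`, indexed by the
ordered pair `e = (i, j)`: block `i` contains `q i - q j`, block `j` contains
`q j - q i`, other blocks are zero. -/
def rigRowV {V : Type*} [DecidableEq V] {d : ℕ} (q : V → Fin d → ℝ) (e : V × V) :
    V → Fin d → ℝ :=
  fun k => if k = e.1 then q e.1 - q e.2 else if k = e.2 then q e.2 - q e.1 else 0

/-- Row of the hyperconnectivity matrix over a vertex type `V`, indexed by the ordered
pair `e = (i, j)`: block `i` contains `w j`, block `j` contains `-w i`, other blocks
are zero. -/
def hypRowV {V : Type*} [DecidableEq V] {d : ℕ} (w : V → Fin d → ℝ) (e : V × V) :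
    V → Fin d → ℝ :=
  fun k => if k = e.1 then w e.2 else if k = e.2 then -w e.1 else 0

/-- For a bipartite vertex set `V = X ⊔ Y` with positions `pᵢ ∈ ℝ^d`, and for edge sets
`E ⊆ X × Y`, the bar-and-joint rigidity matroid of the points `(pᵢ, 0)` for `i ∈ X` and
`(pⱼ, 1)` for `j ∈ Y` coincides with the hyperconnectivity matroid of the vectors
`(pᵢ, 1)`, both in dimension `d + 1`. -/
theorem bipartite_rigidity_eq_hyperconnectivity
    (d : ℕ) (X Y : Type*) [Fintype X] [Fintype Y] [DecidableEq X] [DecidableEq Y]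
    (p : X ⊕ Y → Fin d → ℝ)
    (q : X ⊕ Y → Fin (d + 1) → ℝ)
    (hqX : ∀ x : X, q (Sum.inl x) = Fin.snoc (p (Sum.inl x)) 0)
    (hqY : ∀ y : Y, q (Sum.inr y) = Fin.snoc (p (Sum.inr y)) 1)
    (w : X ⊕ Y → Fin (d + 1) → ℝ)
    (hw : ∀ i, w i = Fin.snoc (p i) 1)
    (E : Set (X × Y)) :
    LinearIndependent ℝ (fun e : E => rigRowV q (Sum.inl e.1.1, Sum.inr e.1.2)) ↔
      LinearIndependent ℝ (fun e : E => hypRowV w (Sum.inl e.1.1, Sum.inr e.1.2)) := by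
  -- the block-wise linear map sending each hyperconnectivity row to the rigidity row
  let s : X ⊕ Y → ℝ := Sum.elim (fun _ => -1) (fun _ => 1)
  let a : X ⊕ Y → Fin (d + 1) → ℝ := fun k =>
    Fin.snoc (p k) (Sum.elim (fun _ => (0 : ℝ)) (fun _ => 2) k)
  let T : (X ⊕ Y → Fin (d + 1) → ℝ) →ₗ[ℝ] (X ⊕ Y → Fin (d + 1) → ℝ) :=
    { toFun := fun f k t => s k * (f k t - f k (Fin.last d) * a k t)
      map_add' := by
        intro f g
        funext k t
        simp only [Pi.add_apply]
        ring
      map_smul' := by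
        intro c f
        funext k t
        simp only [Pi.smul_apply, smul_eq_mul, RingHom.id_apply]
        ring }
  have hTapp : ∀ f k t, T f k t = s k * (f k t - f k (Fin.last d) * a k t) :=
    fun _ _ _ => rfl
  have hT : LinearMap.ker T = ⊥ := by
    rw [LinearMap.ker_eq_bot']
    intro f hf
    have h : ∀ k t, s k * (f k t - f k (Fin.last d) * a k t) = 0 := by
      intro k t
      rw [← hTapp, hf]
      rfl
    have hl : ∀ k, f k (Fin.last d) = 0 := by
      intro k
      have := h k (Fin.last d)
      rcases k with x | y
      · simp [s, a] at this
        exact this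
      · simp [s, a] at this
        linarith
    funext k t
    have := h k t
    rw [hl] at this
    rcases k with x | y
    · simpa [s] using this
    · simpa [s] using this
  have key : (fun e : E => rigRowV q (Sum.inl e.1.1, Sum.inr e.1.2)) =
      T ∘ (fun e : E => hypRowV w (Sum.inl e.1.1, Sum.inr e.1.2)) := by
    funext e k t
    rw [Function.comp_apply, hTapp]
    rcases k with x | y
    · by_cases hx : x = e.1.1
      · subst hx
        refine Fin.lastCases ?_ (fun t => ?_) t <;>
          simp [rigRowV, hypRowV, hqX, hqY, hw, s, a]
      · simp [rigRowV, hypRowV, hx]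
    · by_cases hy : y = e.1.2
      · subst hy
        refine Fin.lastCases ?_ (fun t => ?_) t
        · simp [rigRowV, hypRowV, hqX, hqY, hw, s, a]
          norm_num
        · simp [rigRowV, hypRowV, hqX, hqY, hw, s, a]
          ring
      · simp [rigRowV, hypRowV, hy]
  rw [key]
  exact LinearMap.linearIndependent_iff T hT
end
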